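/- Let H satisfy Assumption (H), let w₀ be the leftmost minimizer of H, let κ be a decreasing L1-kernel which is not identically zero, and let a : [0,∞) → (w_*, w₀] be continuous and increasing. Then the nonlinear integral equation g(t) = H(a(t) + ∫₀^t κ(t−s) g(s) ds), t ≥ 0, has a unique global continuous solution g, given by g(t) = H(f(t)) where f is the unique global continuous solution of f(t) = a(t) + ∫₀^t κ(t−s) H(f(s)) ds; moreover H(a(t)) < g(t) ≤ H(Q₁⁻¹(∫₀^t κ(s) ds, a(0))) < 0 for all t > 0. -/

import Mathlib

open MeasureTheory Set Filter

/-- Assumption (H): `H : (−∞, w_max] → ℝ` (modeled on all of `ℝ`, with all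
conditions imposed on `(−∞, w_max]`) is continuously differentiable and convex,
has a unique root `w_*` in `(−∞, w_max]`, `H′(w_*) < 0` and `H(w_max) < 0`. -/
def AssumptionH (wmax wstar : ℝ) (H : ℝ → ℝ) : Prop :=
  wstar ≤ wmax ∧
  ContDiffOn ℝ 1 H (Set.Iic wmax) ∧
  ConvexOn ℝ (Set.Iic wmax) H ∧
  H wstar = 0 ∧
  (∀ w ∈ Set.Iic wmax, H w = 0 → w = wstar) ∧
  derivWithin H (Set.Iic wmax) wstar < 0 ∧
  H wmax < 0

/-- An `L_p`-kernel: nonnegative on `[0,∞)`, continuous on `(0,∞)`,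
with `∫₀^T κ(t)^p dt < ∞` for all `T > 0`. -/
def IsLpKernel (p : ℝ) (κ : ℝ → ℝ) : Prop :=
  (∀ t, 0 ≤ t → 0 ≤ κ t) ∧ ContinuousOn κ (Set.Ioi 0) ∧
    ∀ T > 0, MeasureTheory.IntegrableOn (fun t => κ t ^ p) (Set.Ioc 0 T)

section Convolution

variable {κ : ℝ → ℝ}

theorem volterra_comm (κ g : ℝ → ℝ) (t : ℝ) :
    ∫ s in (0:ℝ)..t, κ (t - s) * g s = ∫ u in (0:ℝ)..t, κ u * g (t - u) := by
  have h := intervalIntegral.integral_comp_sub_left (a := 0) (b := t)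
    (fun u => κ u * g (t - u)) t
  simpa using h

theorem intervalIntegrable_kernel_Icc (hκi : ∀ T, 0 ≤ T → IntervalIntegrable κ volume 0 T)
    {s t : ℝ} (hs : 0 ≤ s) (ht : 0 ≤ t) : IntervalIntegrable κ volume s t :=
  (hκi s hs).symm.trans (hκi t ht)

theorem intervalIntegrable_kernel_mul (hκi : ∀ T, 0 ≤ T → IntervalIntegrable κ volume 0 T)
    {g : ℝ → ℝ} (hg : ContinuousOn g (Ici 0)) {t : ℝ} (ht : 0 ≤ t) :
    IntervalIntegrable (fun u => κ u * g (t - u)) volume 0 t := by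
  refine (hκi t ht).mul_continuousOn (hg.comp (by fun_prop) ?_)
  intro u hu
  rw [uIcc_of_le ht] at hu
  simpa using hu.2

theorem intervalIntegrable_volterra (hκi : ∀ T, 0 ≤ T → IntervalIntegrable κ volume 0 T)
    {g : ℝ → ℝ} (hg : ContinuousOn g (Ici 0)) {t : ℝ} (ht : 0 ≤ t) :
    IntervalIntegrable (fun s => κ (t - s) * g s) volume 0 t := by
  simpa using ((intervalIntegrable_kernel_mul hκi hg ht).comp_sub_left t).symm

theorem continuousOn_primitive_kernel (hκi : ∀ T, 0 ≤ T → IntervalIntegrable κ volume 0 T) :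
    ContinuousOn (fun t => ∫ s in (0:ℝ)..t, κ s) (Ici 0) := by
  intro t ht
  have ht : 0 ≤ t := ht
  have h := intervalIntegral.continuousOn_primitive_interval (μ := volume)
    (((intervalIntegrable_iff' (by simp)).1 (hκi (t + 1) (by linarith))))
  rw [uIcc_of_le (by linarith)] at h
  refine (h t ⟨ht, by linarith⟩).mono_of_mem_nhdsWithin ?_
  filter_upwards [self_mem_nhdsWithin, mem_nhdsWithin_of_mem_nhds (Iio_mem_nhds (lt_add_one t))]
    with x hx hx' using ⟨hx, le_of_lt hx'⟩

theorem continuousOn_volterra (hκi : ∀ T, 0 ≤ T → IntervalIntegrable κ volume 0 T)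
    {g : ℝ → ℝ} (hg : ContinuousOn g (Ici 0)) :
    ContinuousOn (fun t => ∫ s in (0:ℝ)..t, κ (t - s) * g s) (Ici 0) := by
  set G : ℝ → ℝ := fun s => g (max s 0)
  have hG : Continuous G := hg.comp_continuous (by fun_prop) (fun x => le_max_right x 0)
  set k : ℝ → ℝ := (Ioi 0).indicator κ
  have hk : ∀ u, 0 < u → k u = κ u := fun u hu => indicator_of_mem (show u ∈ Ioi 0 from hu) _
  have heq : ∀ t ∈ Ici (0:ℝ), ∫ s in (0:ℝ)..t, κ (t - s) * g s
      = ∫ u in (0:ℝ)..t, k u * G (t - u) := by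
    intro t ht
    rw [volterra_comm]
    refine intervalIntegral.integral_congr_ae (ae_of_all _ fun u hu => ?_)
    rw [uIoc_of_le ht] at hu
    have : max (t - u) 0 = t - u := max_eq_left (by linarith [hu.2])
    simp [hk u hu.1, G, this]
  refine ContinuousOn.congr ?_ heq
  intro t ht
  have ht : 0 ≤ t := ht
  have hki : IntervalIntegrable k volume (-1) (t + 1) := by
    have h1 : IntervalIntegrable k volume 0 (t + 1) := by
      refine (hκi (t + 1) (by linarith)).congr fun u hu => ?_
      rw [uIoc_of_le (by linarith)] at hu
      exact (hk u hu.1).symm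
    have h0 : IntervalIntegrable k volume (-1) 0 := by
      refine (intervalIntegrable_const (c := (0:ℝ))).congr fun u hu => ?_
      rw [uIoc_of_le (by norm_num)] at hu
      exact (indicator_of_notMem (by simpa using hu.2) _).symm
    exact h0.trans h1
  obtain ⟨M, hM⟩ := (isCompact_Icc (a := -(t + 2)) (b := t + 2)).exists_bound_of_continuousOn
    hG.continuousOn
  have key := intervalIntegral.continuousAt_parametric_primitive_of_dominated
    (μ := volume) (F := fun x u => k u * G (x - u)) (fun u => ‖k u‖ * M) (-1) (t + 1)
    (a₀ := 0) (b₀ := t) (x₀ := t) ?_ ?_ (hki.norm.mul_const M) ?_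
    ⟨by norm_num, by linarith⟩ ⟨by linarith, by linarith⟩ (by simp)
  · exact (ContinuousAt.comp (f := fun x : ℝ => (x, x)) key (by fun_prop)).continuousWithinAt
  · intro x
    exact hki.def'.aestronglyMeasurable.mul (by fun_prop)
  · filter_upwards [Ioo_mem_nhds (sub_one_lt t) (lt_add_one t)] with x hx
    filter_upwards [ae_restrict_mem measurableSet_uIoc] with u hu
    rw [uIoc_of_le (by linarith)] at hu
    rw [norm_mul]
    gcongr
    exact hM _ ⟨by linarith [hx.1, hu.2], by linarith [hx.2, hu.1]⟩
  · exact ae_of_all _ fun u => by fun_prop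

/-- Exponential weights make the kernel uniformly small, as in Bielecki's norm. -/
theorem exists_exp_weight (hκi : ∀ T, 0 ≤ T → IntervalIntegrable κ volume 0 T)
    (hκ0 : ∀ t, 0 < t → 0 ≤ κ t) (hdec : AntitoneOn κ (Ioi 0)) {η : ℝ} (hη : 0 < η) :
    ∃ c > 0, ∀ t ≥ 0, ∫ u in (0:ℝ)..t, κ u * Real.exp (-c * u) ≤ η := by
  obtain ⟨δ, hδ, hKδ⟩ : ∃ δ > 0, ∫ u in (0:ℝ)..δ, κ u < η / 2 := by
    have h := continuousOn_primitive_kernel hκi 0 self_mem_Ici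
    have h' : ∀ᶠ t in nhdsWithin 0 (Ici 0), ∫ u in (0:ℝ)..t, κ u < η / 2 :=
      h.eventually_lt_const (by simpa using by positivity)
    have h2 := (h'.filter_mono (nhdsWithin_mono 0 Ioi_subset_Ici_self)).and self_mem_nhdsWithin
    obtain ⟨δ, h1, h3⟩ := h2.exists
    exact ⟨δ, h3, h1⟩
  have hδ0 := hκ0 δ hδ
  set c := 2 * (κ δ + 1) / η
  have hc : 0 < c := by positivity
  have hcc : κ δ / c ≤ η / 2 := by
    rw [div_le_iff₀ hc]
    simp only [c]
    field_simp
    linarith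
  refine ⟨c, hc, fun t ht => ?_⟩
  have hint : ∀ s ≥ 0, ∀ r ≥ 0,
      IntervalIntegrable (fun u => κ u * Real.exp (-c * u)) volume s r := fun s hs r hr =>
    (intervalIntegrable_kernel_Icc hκi hs hr).mul_continuousOn (by fun_prop)
  have hpos : ∀ u > 0, 0 ≤ κ u * Real.exp (-c * u) := fun u hu =>
    mul_nonneg (hκ0 u hu) (Real.exp_nonneg _)
  have hmono : ∫ u in (0:ℝ)..t, κ u * Real.exp (-c * u)
      ≤ ∫ u in (0:ℝ)..(max t δ), κ u * Real.exp (-c * u) := by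
    refine intervalIntegral.integral_mono_interval le_rfl ht (le_max_left _ _) ?_
      (hint _ le_rfl _ (by positivity))
    filter_upwards [ae_restrict_mem measurableSet_Ioc] with u hu using hpos u hu.1
  refine hmono.trans ?_
  rw [← intervalIntegral.integral_add_adjacent_intervals (hint 0 le_rfl δ hδ.le)
    (hint δ hδ.le _ (by positivity))]
  have h1 : ∫ u in (0:ℝ)..δ, κ u * Real.exp (-c * u) ≤ ∫ u in (0:ℝ)..δ, κ u := by
    refine intervalIntegral.integral_mono_on_of_le_Ioo hδ.le (hint 0 le_rfl δ hδ.le)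
      (hκi δ hδ.le) fun u hu => ?_
    refine mul_le_of_le_one_right (hκ0 u hu.1) (Real.exp_le_one_iff.2 ?_)
    nlinarith [hu.1]
  have h2 : ∫ u in δ..(max t δ), κ u * Real.exp (-c * u)
      ≤ ∫ u in δ..(max t δ), κ δ * Real.exp (-c * u) := by
    refine intervalIntegral.integral_mono_on_of_le_Ioo (le_max_right _ _)
      (hint δ hδ.le _ (by positivity)) (Continuous.intervalIntegrable (by fun_prop) _ _)
      fun u hu => ?_
    gcongr
    exact hdec hδ (hδ.trans hu.1) hu.1.le
  have h3 : ∫ u in δ..(max t δ), κ δ * Real.exp (-c * u) ≤ κ δ / c := by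
    have hd : ∀ u ∈ uIcc δ (max t δ),
        HasDerivAt (fun u => -(κ δ / c) * Real.exp (-c * u)) (κ δ * Real.exp (-c * u)) u := by
      intro u _
      have := (((hasDerivAt_id u).const_mul (-c)).exp).const_mul (-(κ δ / c))
      refine HasDerivAt.congr_deriv this ?_
      simp only [id]
      field_simp
    rw [intervalIntegral.integral_eq_sub_of_hasDerivAt hd
      (Continuous.intervalIntegrable (by fun_prop) _ _)]
    have e1 : Real.exp (-c * δ) ≤ 1 := Real.exp_le_one_iff.2 (by nlinarith)
    have e2 := Real.exp_nonneg (-c * max t δ)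
    have : 0 ≤ κ δ / c := by positivity
    nlinarith
  linarith

theorem exp_mul_abs_volterra_le (hκi : ∀ T, 0 ≤ T → IntervalIntegrable κ volume 0 T)
    (hκ0 : ∀ t, 0 < t → 0 ≤ κ t) {φ : ℝ → ℝ} {c B t : ℝ} (ht : 0 ≤ t)
    (hφ : ∀ s ∈ Icc 0 t, |φ s| ≤ B * Real.exp (c * s)) :
    Real.exp (-c * t) * |∫ s in (0:ℝ)..t, κ (t - s) * φ s|
      ≤ B * ∫ u in (0:ℝ)..t, κ u * Real.exp (-c * u) := by
  have hi : IntervalIntegrable (fun u => κ u * Real.exp (-c * u)) volume 0 t :=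
    (hκi t ht).mul_continuousOn (by fun_prop)
  have h1 : |∫ s in (0:ℝ)..t, κ (t - s) * φ s|
      ≤ ∫ u in (0:ℝ)..t, (B * Real.exp (c * t)) * (κ u * Real.exp (-c * u)) := by
    rw [volterra_comm, ← Real.norm_eq_abs]
    refine intervalIntegral.norm_integral_le_of_norm_le ht (ae_of_all _ fun u hu => ?_)
      (hi.const_mul _)
    have hb := hφ (t - u) ⟨by linarith [hu.2], by linarith [hu.1]⟩
    have he : Real.exp (c * (t - u)) = Real.exp (c * t) * Real.exp (-c * u) := by
      rw [← Real.exp_add]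
      ring_nf
    rw [Real.norm_eq_abs, abs_mul, abs_of_nonneg (hκ0 u hu.1)]
    calc κ u * |φ (t - u)| ≤ κ u * (B * Real.exp (c * (t - u))) :=
          mul_le_mul_of_nonneg_left hb (hκ0 u hu.1)
      _ = _ := by rw [he]; ring
  rw [intervalIntegral.integral_const_mul] at h1
  have he : Real.exp (-c * t) * Real.exp (c * t) = 1 := by
    rw [← Real.exp_add]
    simp
  calc _ ≤ Real.exp (-c * t) * (B * Real.exp (c * t) *
          ∫ u in (0:ℝ)..t, κ u * Real.exp (-c * u)) :=
        mul_le_mul_of_nonneg_left h1 (Real.exp_nonneg _)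
    _ = (Real.exp (-c * t) * Real.exp (c * t)) *
          (B * ∫ u in (0:ℝ)..t, κ u * Real.exp (-c * u)) := by ring
    _ = _ := by rw [he, one_mul]

theorem exists_volterra_solution (hκi : ∀ T, 0 ≤ T → IntervalIntegrable κ volume 0 T)
    (hκ0 : ∀ t, 0 < t → 0 ≤ κ t) (hdec : AntitoneOn κ (Ioi 0))
    {a G : ℝ → ℝ} (ha : ContinuousOn a (Ici 0)) {A : ℝ} (hab : ∀ t ≥ 0, |a t| ≤ A)
    {L : NNReal} (hG : LipschitzWith L G) {C : ℝ} (hGb : ∀ x, |G x| ≤ C) :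
    ∃ f : ℝ → ℝ, ContinuousOn f (Ici 0) ∧
      ∀ t ≥ 0, f t = a t + ∫ s in (0:ℝ)..t, κ (t - s) * G (f s) := by
  have hL1 : (0:ℝ) < 2 * (L + 1) := by positivity
  obtain ⟨c, hc, hw⟩ := exists_exp_weight hκi hκ0 hdec (inv_pos.2 hL1)
  have hC : 0 ≤ C := (abs_nonneg _).trans (hGb 0)
  set N : BoundedContinuousFunction ℝ ℝ → ℝ → ℝ := fun y s => G (Real.exp (c * s) * y s)
  have hN : ∀ y, Continuous (N y) := fun y => hG.continuous.comp (by fun_prop)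
  set V : BoundedContinuousFunction ℝ ℝ → ℝ → ℝ := fun y t =>
    a t + ∫ s in (0:ℝ)..t, κ (t - s) * N y s
  have hV : ∀ y, ContinuousOn (V y) (Ici 0) := fun y =>
    ha.add (continuousOn_volterra hκi (hN y).continuousOn)
  have hVb : ∀ y t, ‖Real.exp (-c * max t 0) * V y (max t 0)‖ ≤ A + C * (2 * (L + 1 : ℝ))⁻¹ := by
    intro y t
    have ht : 0 ≤ max t 0 := le_max_right _ _
    set r := max t 0
    have h1 := exp_mul_abs_volterra_le (c := c) (B := C) hκi hκ0 (φ := N y) ht (fun s hs => by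
      refine (hGb _).trans (le_mul_of_one_le_right hC (Real.one_le_exp (mul_nonneg hc.le hs.1))))
    have h2 : Real.exp (-c * r) ≤ 1 := Real.exp_le_one_iff.2 (by nlinarith)
    have h3 := hab r ht
    have h4 : Real.exp (-c * r) * |a r| ≤ A :=
      (mul_le_of_le_one_left (abs_nonneg _) h2).trans h3
    have h5 := mul_le_mul_of_nonneg_left (hw r ht) hC
    rw [norm_mul, Real.norm_eq_abs, Real.norm_eq_abs, abs_of_nonneg (Real.exp_nonneg _)]
    have h6 := mul_le_mul_of_nonneg_left
      (abs_add_le (a r) (∫ s in (0:ℝ)..r, κ (r - s) * N y s)) (Real.exp_nonneg (-c * r))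
    simp only [V]
    linarith
  set Φ : BoundedContinuousFunction ℝ ℝ → BoundedContinuousFunction ℝ ℝ := fun y =>
    BoundedContinuousFunction.ofNormedAddCommGroup
      (fun t => Real.exp (-c * max t 0) * V y (max t 0))
      (Continuous.mul (by fun_prop)
        ((hV y).comp_continuous (by fun_prop) (fun x => le_max_right x 0))) _ (hVb y)
  have hΦ : ContractingWith (1 / 2) Φ := by
    refine ⟨by norm_num, LipschitzWith.of_dist_le_mul fun y z => ?_⟩
    refine (BoundedContinuousFunction.dist_le (by positivity)).2 fun t => ?_
    have ht : 0 ≤ max t 0 := le_max_right _ _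
    simp only [Φ, BoundedContinuousFunction.coe_ofNormedAddCommGroup]
    set r := max t 0
    have h1 := exp_mul_abs_volterra_le (c := c) (B := L * dist y z) hκi hκ0
      (φ := fun s => N y s - N z s) ht (fun s hs => by
        have := hG.dist_le_mul (Real.exp (c * s) * y s) (Real.exp (c * s) * z s)
        rw [Real.dist_eq, Real.dist_eq, ← mul_sub, abs_mul,
          abs_of_nonneg (Real.exp_nonneg _)] at this
        refine this.trans ?_
        rw [mul_assoc, mul_comm (dist y z)]
        gcongr
        exact (Real.dist_eq _ _).symm.trans_le
          (BoundedContinuousFunction.dist_coe_le_dist (f := y) (g := z) s))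
    have h2 : ∫ s in (0:ℝ)..r, κ (r - s) * (N y s - N z s) = V y r - V z r := by
      simp only [V, mul_sub]
      rw [intervalIntegral.integral_sub
        (intervalIntegrable_volterra hκi (hN y).continuousOn ht)
        (intervalIntegrable_volterra hκi (hN z).continuousOn ht)]
      ring
    rw [h2] at h1
    rw [Real.dist_eq, ← mul_sub, abs_mul, abs_of_nonneg (Real.exp_nonneg _)]
    refine h1.trans ((mul_le_mul_of_nonneg_left (hw r ht) (by positivity)).trans ?_)
    have hd : 0 ≤ dist y z := dist_nonneg
    have hLL : (L : ℝ) * (2 * (L + 1 : ℝ))⁻¹ ≤ 1 / 2 := by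
      rw [← div_eq_mul_inv, div_le_iff₀ hL1]
      linarith
    calc (L : ℝ) * dist y z * (2 * (L + 1 : ℝ))⁻¹
        = (L : ℝ) * (2 * (L + 1 : ℝ))⁻¹ * dist y z := by ring
      _ ≤ 1 / 2 * dist y z := by gcongr
      _ = _ := by norm_num
  obtain ⟨y, hy⟩ : ∃ y, Φ y = y := ⟨_, hΦ.fixedPoint_isFixedPt⟩
  refine ⟨fun t => Real.exp (c * t) * y t, by fun_prop, fun t ht => ?_⟩
  have h := congrArg (fun w : BoundedContinuousFunction ℝ ℝ => w t) hy
  simp only [Φ, BoundedContinuousFunction.coe_ofNormedAddCommGroup, max_eq_left ht] at h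
  have he : Real.exp (c * t) * Real.exp (-c * t) = 1 := by
    rw [← Real.exp_add]
    simp
  calc Real.exp (c * t) * y t
      = (Real.exp (c * t) * Real.exp (-c * t)) * V y t := by rw [← h]; ring
    _ = _ := by rw [he, one_mul]

theorem volterra_solution_unique (hκi : ∀ T, 0 ≤ T → IntervalIntegrable κ volume 0 T)
    (hκ0 : ∀ t, 0 < t → 0 ≤ κ t) (hdec : AntitoneOn κ (Ioi 0))
    {a H f₁ f₂ : ℝ → ℝ} (hf₁ : ContinuousOn f₁ (Ici 0)) (hf₂ : ContinuousOn f₂ (Ici 0))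
    (hH₁ : ContinuousOn (fun t => H (f₁ t)) (Ici 0))
    (hH₂ : ContinuousOn (fun t => H (f₂ t)) (Ici 0))
    (hL : ∀ T ≥ 0, ∃ L ≥ 0, ∀ t ∈ Icc 0 T, |H (f₁ t) - H (f₂ t)| ≤ L * |f₁ t - f₂ t|)
    (h₁ : ∀ t ≥ 0, f₁ t = a t + ∫ s in (0:ℝ)..t, κ (t - s) * H (f₁ s))
    (h₂ : ∀ t ≥ 0, f₂ t = a t + ∫ s in (0:ℝ)..t, κ (t - s) * H (f₂ s)) :
    ∀ t ≥ 0, f₁ t = f₂ t := by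
  intro T hT
  obtain ⟨L, hL0, hL⟩ := hL T hT
  have hL1 : (0:ℝ) < 2 * (L + 1) := by positivity
  obtain ⟨c, hc, hw⟩ := exists_exp_weight hκi hκ0 hdec (inv_pos.2 hL1)
  set D : ℝ → ℝ := fun t => Real.exp (-c * t) * |f₁ t - f₂ t|
  have hDc : ContinuousOn D (Icc 0 T) :=
    (ContinuousOn.mul (by fun_prop) (hf₁.sub hf₂).abs).mono fun x hx => hx.1
  obtain ⟨r, hr, hmax⟩ := isCompact_Icc.exists_isMaxOn (nonempty_Icc.2 hT) hDc
  have hD0 : ∀ t, 0 ≤ D t := fun t => by positivity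
  have h := exp_mul_abs_volterra_le (c := c) (B := L * D r) hκi hκ0
    (φ := fun s => H (f₁ s) - H (f₂ s)) hr.1 (fun s hs => by
      have hsT : s ∈ Icc 0 T := ⟨hs.1, hs.2.trans hr.2⟩
      have hm : D s ≤ D r := hmax hsT
      have he : D s * Real.exp (c * s) = |f₁ s - f₂ s| := by
        have : Real.exp (-c * s) * Real.exp (c * s) = 1 := by
          rw [← Real.exp_add]
          simp
        simp only [D]
        linear_combination |f₁ s - f₂ s| * this
      calc _ ≤ L * |f₁ s - f₂ s| := hL s hsT
        _ = L * D s * Real.exp (c * s) := by rw [← he]; ring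
        _ ≤ _ := by gcongr)
  have h2 : ∫ s in (0:ℝ)..r, κ (r - s) * (H (f₁ s) - H (f₂ s)) = f₁ r - f₂ r := by
    rw [h₁ r hr.1, h₂ r hr.1]
    simp only [mul_sub]
    rw [intervalIntegral.integral_sub (intervalIntegrable_volterra hκi hH₁ hr.1)
      (intervalIntegrable_volterra hκi hH₂ hr.1)]
    ring
  rw [h2] at h
  have h3 : D r ≤ L * D r * (2 * (L + 1))⁻¹ :=
    h.trans (mul_le_mul_of_nonneg_left (hw r hr.1) (mul_nonneg hL0 (hD0 r)))
  have h4 : D r ≤ 0 := by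
    rw [← div_eq_mul_inv, le_div_iff₀ hL1] at h3
    nlinarith [mul_nonneg hL0 (hD0 r)]
  have h5 : D T ≤ D r := hmax (right_mem_Icc.2 hT)
  have h6 : |f₁ T - f₂ T| ≤ 0 := by
    by_contra! hlt
    have : 0 < D T := by positivity
    linarith
  linarith [abs_nonpos_iff.1 h6]

theorem integral_kernel_mono (hκi : ∀ T, 0 ≤ T → IntervalIntegrable κ volume 0 T)
    (hκ0 : ∀ t, 0 < t → 0 ≤ κ t) {s t : ℝ} (hs : 0 ≤ s) (hst : s ≤ t) :
    ∫ r in (0:ℝ)..s, κ r ≤ ∫ r in (0:ℝ)..t, κ r := by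
  refine intervalIntegral.integral_mono_interval le_rfl hs hst ?_ (hκi t (hs.trans hst))
  filter_upwards [ae_restrict_mem measurableSet_Ioc] with u hu using hκ0 u hu.1

theorem volterra_diff_le (hκi : ∀ T, 0 ≤ T → IntervalIntegrable κ volume 0 T)
    (hκ0 : ∀ t, 0 < t → 0 ≤ κ t) (hdec : AntitoneOn κ (Ioi 0))
    {h : ℝ → ℝ} (hh : ContinuousOn h (Ici 0)) {s t m B : ℝ} (hs : 0 ≤ s) (hst : s ≤ t)
    (hm : ∀ r ∈ Icc 0 t, m ≤ h r) (hB : ∀ r ∈ Icc s t, h r - m ≤ B) :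
    (∫ r in (0:ℝ)..t, κ (t - r) * h r) - ∫ r in (0:ℝ)..s, κ (s - r) * h r
      ≤ m * ((∫ r in (0:ℝ)..t, κ r) - ∫ r in (0:ℝ)..s, κ r)
        + B * ∫ r in (0:ℝ)..(t - s), κ r := by
  have ht : 0 ≤ t := hs.trans hst
  set φ : ℝ → ℝ := fun r => h r - m
  have hφ : ContinuousOn φ (Ici 0) := hh.sub continuousOn_const
  have hsplit : ∀ x ≥ 0, ∫ r in (0:ℝ)..x, κ (x - r) * h r
      = (∫ r in (0:ℝ)..x, κ (x - r) * φ r) + m * ∫ r in (0:ℝ)..x, κ r := by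
    intro x hx
    have e1 : ∫ r in (0:ℝ)..x, κ (x - r) * m = m * ∫ r in (0:ℝ)..x, κ r := by
      rw [intervalIntegral.integral_mul_const, intervalIntegral.integral_comp_sub_left]
      simp [mul_comm]
    rw [← e1, ← intervalIntegral.integral_add (intervalIntegrable_volterra hκi hφ hx)
      (intervalIntegrable_volterra hκi continuousOn_const hx)]
    congr 1
    ext r
    simp only [φ]
    ring
  have hit := intervalIntegrable_volterra hκi hφ ht
  have hi1 : IntervalIntegrable (fun r => κ (t - r) * φ r) volume 0 s :=
    hit.mono_set (by rw [uIcc_of_le hs, uIcc_of_le ht]; exact Icc_subset_Icc_right hst)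
  have hi2 : IntervalIntegrable (fun r => κ (t - r) * φ r) volume s t :=
    hit.mono_set (by rw [uIcc_of_le hst, uIcc_of_le ht]; exact Icc_subset_Icc_left hs)
  have h1 : ∫ r in (0:ℝ)..s, κ (t - r) * φ r ≤ ∫ r in (0:ℝ)..s, κ (s - r) * φ r := by
    refine intervalIntegral.integral_mono_on_of_le_Ioo hs hi1
      (intervalIntegrable_volterra hκi hφ hs) fun r hr => ?_
    refine mul_le_mul_of_nonneg_right (hdec ?_ ?_ (by linarith)) ?_
    · exact sub_pos.2 hr.2
    · exact sub_pos.2 (hr.2.trans_le hst)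
    · exact sub_nonneg.2 (hm r ⟨hr.1.le, hr.2.le.trans hst⟩)
  have h2 : ∫ r in s..t, κ (t - r) * φ r ≤ B * ∫ r in (0:ℝ)..(t - s), κ r := by
    have e1 : B * ∫ r in (0:ℝ)..(t - s), κ r = ∫ r in s..t, κ (t - r) * B := by
      rw [intervalIntegral.integral_mul_const, intervalIntegral.integral_comp_sub_left]
      simp [mul_comm]
    rw [e1]
    refine intervalIntegral.integral_mono_on_of_le_Ioo hst hi2 ?_ fun r hr => ?_
    · exact (intervalIntegrable_volterra (g := fun _ => B) hκi continuousOn_const ht).mono_set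
        (by rw [uIcc_of_le hst, uIcc_of_le ht]; exact Icc_subset_Icc_left hs)
    · exact mul_le_mul_of_nonneg_left (hB r ⟨hr.1.le, hr.2.le⟩) (hκ0 _ (sub_pos.2 hr.2))
  rw [hsplit t ht, hsplit s hs, ← intervalIntegral.integral_add_adjacent_intervals hi1 hi2]
  linarith

/-- A strict subsolution of `r' = κ H(r)` starting below the solution of the Volterra equation
stays below it: at a first contact time the solution attains its running minimum, and
monotonicity of the kernel bounds its decrease up to an absorbable error. -/
theorem volterra_solution_gt_of_subsolution
    (hκi : ∀ T, 0 ≤ T → IntervalIntegrable κ volume 0 T)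
    (hκ0 : ∀ t, 0 < t → 0 ≤ κ t) (hdec : AntitoneOn κ (Ioi 0))
    {a G f ρ : ℝ → ℝ} (hamono : MonotoneOn a (Ici 0)) (hG : Antitone G)
    {L : NNReal} (hGL : LipschitzWith L G) (hf : ContinuousOn f (Ici 0))
    (hfeq : ∀ t ≥ 0, f t = a t + ∫ s in (0:ℝ)..t, κ (t - s) * G (f s))
    (hρ : ContinuousOn ρ (Ici 0)) (hρanti : AntitoneOn ρ (Ici 0)) (hρ0 : ρ 0 < f 0)
    {ε : ℝ} (hε : 0 < ε)
    (hρG : ∀ s t, 0 ≤ s → s ≤ t →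
      (1 + ε) * ((∫ r in (0:ℝ)..t, κ r) - ∫ r in (0:ℝ)..s, κ r) * (-G (ρ t)) ≤ ρ s - ρ t) :
    ∀ t ≥ 0, ρ t < f t := by
  by_contra! hcon
  obtain ⟨t₀, ht₀, hle⟩ := hcon
  set S := Ici (0:ℝ) ∩ {t | f t ≤ ρ t}
  have hS : IsClosed S := by
    have := (hρ.sub hf).preimage_isClosed_of_isClosed isClosed_Ici (isClosed_Ici (a := (0:ℝ)))
    convert this using 1
    ext t
    simp [S]
  have hmem : sInf S ∈ S := hS.csInf_mem ⟨t₀, ht₀, hle⟩ ⟨0, fun x hx => hx.1⟩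
  set t := sInf S
  have ht0 : 0 ≤ t := hmem.1
  have htle : f t ≤ ρ t := hmem.2
  have hlt : ∀ s, 0 ≤ s → s < t → ρ s < f s := by
    intro s hs hst
    by_contra! hc
    exact absurd (csInf_le ⟨0, fun x hx => hx.1⟩ (show s ∈ S from ⟨hs, hc⟩)) (not_le.2 hst)
  have htpos : 0 < t := by
    rcases ht0.eq_or_lt with h | h
    · rw [← h] at htle
      linarith
    · exact h
  have hmin : ∀ s ∈ Icc 0 t, f t ≤ f s := by
    intro s hs
    rcases hs.2.eq_or_lt with h | h
    · rw [h]
    · exact htle.trans ((hρanti hs.1 ht0 hs.2).trans (hlt s hs.1 h).le)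
  set η := ε / (1 + ε)
  have hη : 0 < η := by positivity
  obtain ⟨δ, hδ, hδt, hKδ⟩ : ∃ δ > 0, δ < t ∧ L * (∫ u in (0:ℝ)..δ, κ u) < η := by
    have h := (continuousOn_primitive_kernel hκi 0 self_mem_Ici).const_mul (L : ℝ)
    have h' : ∀ᶠ x in nhdsWithin 0 (Ici 0), L * (∫ u in (0:ℝ)..x, κ u) < η :=
      h.eventually_lt_const (by simpa using hη)
    have h2 := ((h'.filter_mono (nhdsWithin_mono 0 Ioi_subset_Ici_self)).and
      self_mem_nhdsWithin).and (mem_nhdsWithin_of_mem_nhds (Iio_mem_nhds htpos))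
    obtain ⟨δ, ⟨h1, h3⟩, h4⟩ := h2.exists
    exact ⟨δ, h3, h4, h1⟩
  obtain ⟨s, hs, hmax⟩ := isCompact_Icc.exists_isMaxOn
    (nonempty_Icc.2 (show t - δ ≤ t by linarith))
    (hf.mono fun x hx => (by linarith [hx.1] : (0:ℝ) ≤ x))
  have hs0 : 0 ≤ s := by linarith [hs.1]
  have hM : f t < f s := by
    have h1 : f (t - δ) ≤ f s := hmax ⟨le_rfl, by linarith⟩
    have h2 := hlt (t - δ) (by linarith) (by linarith)
    have h3 := hρanti (show (0:ℝ) ≤ t - δ by linarith) ht0 (by linarith)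
    linarith
  have hst : s < t := lt_of_le_of_ne hs.2 fun h => by simp [h] at hM
  have hft : ρ s - ρ t < f s - f t := by linarith [hlt s hs0 hst]
  have hsub := hρG s t hs0 hst.le
  have hGf : G (ρ t) ≤ G (f t) := hG htle
  have hd := volterra_diff_le hκi hκ0 hdec (h := fun r => -G (f r)) (m := -G (f t))
    (B := L * (f s - f t)) ((hGL.continuous.comp_continuousOn hf).neg) hs0 hst.le
    (fun r hr => neg_le_neg (hG (hmin r hr)))
    (fun r hr => by
      have h1 := hGL.dist_le_mul (f t) (f r)
      have h2 : f r ≤ f s := hmax ⟨hs.1.trans hr.1, hr.2⟩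
      have h3 := hmin r ⟨hs0.trans hr.1, hr.2⟩
      rw [Real.dist_eq, Real.dist_eq, abs_sub_comm (f t), abs_of_nonneg (sub_nonneg.2 h3)] at h1
      have h4 := (le_abs_self _).trans h1
      have h5 : (L : ℝ) * (f r - f t) ≤ L * (f s - f t) := by gcongr
      linarith)
  simp only [mul_neg, intervalIntegral.integral_neg] at hd
  have hfs := hfeq s hs0
  have hft' := hfeq t ht0
  have ha := hamono hs0 ht0 hst.le
  have hK1 := integral_kernel_mono hκi hκ0 hs0 hst.le
  have hK2 := integral_kernel_mono hκi hκ0 (show 0 ≤ t - s by linarith)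
    (show t - s ≤ δ by linarith [hs.1])
  set K := (∫ r in (0:ℝ)..t, κ r) - ∫ r in (0:ℝ)..s, κ r
  have hMpos : 0 < f s - f t := by linarith
  have h7 : (f s - f t) * (L * ∫ r in (0:ℝ)..(t - s), κ r) ≤ (f s - f t) * η := by
    refine mul_le_mul_of_nonneg_left ?_ hMpos.le
    have : (L : ℝ) * (∫ r in (0:ℝ)..(t - s), κ r) ≤ L * ∫ u in (0:ℝ)..δ, κ u := by gcongr
    linarith
  have h8 : (f s - f t) * (1 - η) ≤ -G (f t) * K := by linarith
  have h9 : (1 + ε) * (1 - η) = 1 := by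
    simp only [η]
    field_simp
    ring
  have h10 : f s - f t ≤ (1 + ε) * K * (-G (f t)) := by
    have := mul_le_mul_of_nonneg_left h8 (show 0 ≤ 1 + ε by linarith)
    calc f s - f t = (1 + ε) * ((f s - f t) * (1 - η)) := by linear_combination -(f s - f t) * h9
      _ ≤ _ := this
      _ = _ := by ring
  have h11 : (1 + ε) * K * (-G (f t)) ≤ (1 + ε) * K * (-G (ρ t)) := by
    refine mul_le_mul_of_nonneg_left (neg_le_neg hGf) ?_
    have : 0 ≤ K := by linarith
    positivity
  linarith

theorem volterra_solution_ge
    (hκi : ∀ T, 0 ≤ T → IntervalIntegrable κ volume 0 T)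
    (hκ0 : ∀ t, 0 < t → 0 ≤ κ t) (hdec : AntitoneOn κ (Ioi 0))
    {a G f P : ℝ → ℝ} (hamono : MonotoneOn a (Ici 0)) (hG : Antitone G)
    {L : NNReal} (hGL : LipschitzWith L G) (hf : ContinuousOn f (Ici 0))
    (hfeq : ∀ t ≥ 0, f t = a t + ∫ s in (0:ℝ)..t, κ (t - s) * G (f s))
    (hPneg : ∀ c ≥ 0, G (P c) < 0) {C : ℝ}
    (hP : ∀ c d, 0 ≤ c → c ≤ d →
      (d - c) * (-G (P d)) ≤ P c - P d ∧ P c - P d ≤ (d - c) * C)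
    (hP0 : P 0 ≤ f 0) :
    ∀ t ≥ 0, P (∫ s in (0:ℝ)..t, κ s) ≤ f t := by
  intro t ht
  set K : ℝ → ℝ := fun t => ∫ s in (0:ℝ)..t, κ s
  have hK : ContinuousOn K (Ici 0) := continuousOn_primitive_kernel hκi
  have hKmono : ∀ s t, 0 ≤ s → s ≤ t → K s ≤ K t := fun s t hs hst =>
    integral_kernel_mono hκi hκ0 hs hst
  have hK0 : ∀ t, 0 ≤ t → 0 ≤ K t := fun t ht => by simpa [K] using hKmono 0 t le_rfl ht
  have hPanti : ∀ c d, 0 ≤ c → c ≤ d → P d ≤ P c := fun c d hc hcd => by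
    have h1 := (hP c d hc hcd).1
    have h2 := mul_nonneg (sub_nonneg.2 hcd) (neg_nonneg.2 (hPneg d (hc.trans hcd)).le)
    linarith
  have hPc : ContinuousOn P (Ici 0) := by
    have hC : ∀ c ∈ Ici (0:ℝ), ∀ d ∈ Ici (0:ℝ), c ≤ d →
        dist (P c) (P d) ≤ C.toNNReal * dist c d := fun c hc d hd hcd => by
      rw [Real.dist_eq, dist_comm, Real.dist_eq, abs_of_nonneg (sub_nonneg.2 hcd),
        abs_of_nonneg (sub_nonneg.2 (hPanti c d hc hcd)), mul_comm]
      exact (hP c d hc hcd).2.trans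
        (mul_le_mul_of_nonneg_left (Real.le_coe_toNNReal C) (sub_nonneg.2 hcd))
    refine (LipschitzOnWith.of_dist_le_mul (K := C.toNNReal) fun c hc d hd => ?_).continuousOn
    rcases le_total c d with h | h
    · exact hC c hc d hd h
    · rw [dist_comm, dist_comm c]
      exact hC d hd c hc h
  have hgt : ∀ ε > 0, P ((1 + ε) * K t + ε) < f t := by
    intro ε hε
    have hφ : ∀ s, 0 ≤ s → 0 ≤ (1 + ε) * K s + ε := fun s hs => by
      have := hK0 s hs
      positivity
    have hφmono : ∀ s r, 0 ≤ s → s ≤ r → (1 + ε) * K s + ε ≤ (1 + ε) * K r + ε :=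
      fun s r hs hsr => by
        have := hKmono s r hs hsr
        gcongr
    refine volterra_solution_gt_of_subsolution hκi hκ0 hdec hamono hG hGL hf hfeq
      (ρ := fun t => P ((1 + ε) * K t + ε)) ?_ ?_ ?_ hε ?_ t ht
    · exact hPc.comp (by fun_prop) fun s hs => hφ s hs
    · exact fun s hs r _ hsr => hPanti _ _ (hφ s hs) (hφmono s r hs hsr)
    · have h1 := (hP 0 ε le_rfl hε.le).1
      have h2 : 0 < (ε - 0) * (-G (P ε)) := by
        have := hPneg ε hε.le
        simp only [sub_zero]
        nlinarith
      have h3 : (1 + ε) * K 0 + ε = ε := by simp [K]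
      simp only [h3]
      linarith
    · intro s r hs hsr
      have h1 := (hP _ _ (hφ s hs) (hφmono s r hs hsr)).1
      refine le_trans (le_of_eq ?_) h1
      simp only [K]
      ring
  refine le_of_forall_pos_le_add fun η hη => ?_
  have hKt := hK0 t ht
  set ε := η / ((K t + 1) * (|C| + 1))
  have hε : 0 < ε := by positivity
  have h1 := hgt ε hε
  have h2 := (hP (K t) ((1 + ε) * K t + ε) hKt (by nlinarith)).2
  have h3 : ((1 + ε) * K t + ε - K t) * C ≤ η := by
    calc ((1 + ε) * K t + ε - K t) * C = ε * (K t + 1) * C := by ring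
      _ ≤ ε * (K t + 1) * (|C| + 1) := by
          gcongr
          linarith [le_abs_self C]
      _ = η := by
          simp only [ε]
          field_simp
  change P (K t) ≤ f t + η
  linarith

theorem volterra_neg (hκi : ∀ T, 0 ≤ T → IntervalIntegrable κ volume 0 T)
    (hκ0 : ∀ t, 0 < t → 0 ≤ κ t) (hdec : AntitoneOn κ (Ioi 0)) (hne : ∃ t > 0, κ t ≠ 0)
    {h : ℝ → ℝ} (hh : ContinuousOn h (Ici 0)) (hneg : ∀ t ≥ 0, h t < 0) {t : ℝ} (ht : 0 < t) :
    ∫ s in (0:ℝ)..t, κ (t - s) * h s < 0 := by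
  obtain ⟨t₀, ht₀, hκt⟩ := hne
  have hκpos : 0 < κ t₀ := (hκ0 t₀ ht₀).lt_of_ne' hκt
  have hm : 0 < min t t₀ := lt_min ht ht₀
  have hi := intervalIntegrable_kernel_mul hκi hh ht.le
  have hmt : min t t₀ ∈ Icc 0 t := ⟨hm.le, min_le_left _ _⟩
  have hi1 : IntervalIntegrable (fun u => κ u * h (t - u)) volume 0 (min t t₀) :=
    hi.mono_set (by
      rw [uIcc_of_le hm.le, uIcc_of_le ht.le]; exact Icc_subset_Icc_right hmt.2)
  have hi2 : IntervalIntegrable (fun u => κ u * h (t - u)) volume (min t t₀) t :=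
    hi.mono_set (by
      rw [uIcc_of_le hmt.2, uIcc_of_le ht.le]; exact Icc_subset_Icc_left hmt.1)
  rw [volterra_comm, ← intervalIntegral.integral_add_adjacent_intervals hi1 hi2]
  have h1 := intervalIntegral.intervalIntegral_pos_of_pos_on hi1.neg (fun u hu => by
    have hk : 0 < κ u := hκpos.trans_le
      (hdec hu.1 ht₀ (hu.2.le.trans (min_le_right _ _)))
    have := mul_neg_of_pos_of_neg hk (hneg (t - u) (by linarith [hu.2, hmt.2]))
    simpa using this) hm
  have h2 : 0 ≤ ∫ u in (min t t₀)..t, -(κ u * h (t - u)) :=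
    intervalIntegral.integral_nonneg hmt.2 fun u hu => by
      have := mul_nonpos_of_nonneg_of_nonpos (hκ0 u (hm.trans_le hu.1))
        (hneg (t - u) (by linarith [hu.2])).le
      linarith
  simp only [Pi.neg_apply, intervalIntegral.integral_neg] at h1 h2
  linarith

theorem volterra_nonpos (hκ0 : ∀ t, 0 < t → 0 ≤ κ t) {h : ℝ → ℝ} (hneg : ∀ x, h x ≤ 0)
    {t : ℝ} (ht : 0 ≤ t) : ∫ s in (0:ℝ)..t, κ (t - s) * h s ≤ 0 := by
  have h1 : 0 ≤ ∫ s in (0:ℝ)..t, -(κ (t - s) * h s) := by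
    refine intervalIntegral.integral_nonneg_of_ae_restrict ht ?_
    rw [Filter.EventuallyLE, ← restrict_Ioo_eq_restrict_Icc]
    filter_upwards [ae_restrict_mem measurableSet_Ioo] with s hs
    have := mul_nonpos_of_nonneg_of_nonpos (hκ0 (t - s) (sub_pos.2 hs.2)) (hneg s)
    simpa using this
  rw [intervalIntegral.integral_neg] at h1
  linarith

end Convolution

theorem AssumptionH.neg_of_mem_Ioc {wmax wstar : ℝ} {H : ℝ → ℝ} (hH : AssumptionH wmax wstar H)
    {w : ℝ} (hw : w ∈ Ioc wstar wmax) : H w < 0 := by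
  obtain ⟨h1, -, hconv, hroot, -, -, hneg⟩ := hH
  have hlt : wstar < wmax := hw.1.trans_le hw.2
  have hd : 0 < wmax - wstar := sub_pos.2 hlt
  have h := hconv.2 (mem_Iic.2 h1) self_mem_Iic
    (show 0 ≤ (wmax - w) / (wmax - wstar) from div_nonneg (sub_nonneg.2 hw.2) hd.le)
    (show 0 ≤ (w - wstar) / (wmax - wstar) from div_nonneg (sub_nonneg.2 hw.1.le) hd.le)
    (by field_simp; ring)
  have e : ((wmax - w) / (wmax - wstar)) • wstar + ((w - wstar) / (wmax - wstar)) • wmax = w := by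
    simp only [smul_eq_mul]
    field_simp
    ring
  rw [e, hroot] at h
  have : 0 < (w - wstar) / (wmax - wstar) := div_pos (sub_pos.2 hw.1) hd
  simp only [smul_eq_mul] at h
  nlinarith

theorem AssumptionH.exists_lipschitzOnWith {wmax wstar : ℝ} {H : ℝ → ℝ}
    (hH : AssumptionH wmax wstar H) (m : ℝ) :
    ∃ L : NNReal, LipschitzOnWith L H (Icc m wmax) := by
  have hcd := hH.2.1
  have hsub : Icc m wmax ⊆ Iic wmax := fun x hx => hx.2
  have hdc := (hcd.continuousOn_derivWithin (uniqueDiffOn_Iic wmax) le_rfl).mono hsub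
  obtain ⟨C, hC⟩ := isCompact_Icc.exists_bound_of_continuousOn hdc
  refine ⟨C.toNNReal, LipschitzOnWith.of_dist_le_mul fun x hx y hy => ?_⟩
  rw [dist_eq_norm, dist_eq_norm]
  refine (Convex.norm_image_sub_le_of_norm_hasDerivWithin_le
    (fun z hz => (((hcd.differentiableOn one_ne_zero) z (hsub hz)).hasDerivWithinAt).mono hsub)
    hC (convex_Icc m wmax) hy hx).trans ?_
  gcongr
  exact Real.le_coe_toNNReal C

theorem ConvexOn.strictAntiOn_of_leftmost_minimizer {wmax w0 : ℝ} {H : ℝ → ℝ}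
    (hconv : ConvexOn ℝ (Iic wmax) H) (hw0 : w0 ≤ wmax)
    (hmin : ∀ w ∈ Iic wmax, H w0 ≤ H w) (hleft : ∀ w ∈ Iic wmax, H w = H w0 → w0 ≤ w) :
    StrictAntiOn H (Iic w0) := by
  intro x hx y hy hxy
  have hx' : x < w0 := hxy.trans_le hy
  have hxm : x ∈ Iic wmax := hx'.le.trans hw0
  have hlt : H w0 < H x := (hmin x hxm).lt_of_ne fun h => absurd (hleft x hxm h.symm) (not_le.2 hx')
  have hd : 0 < w0 - x := sub_pos.2 hx'
  have h := hconv.2 hxm (mem_Iic.2 hw0)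
    (show 0 ≤ (w0 - y) / (w0 - x) from div_nonneg (sub_nonneg.2 hy) hd.le)
    (show 0 ≤ (y - x) / (w0 - x) from div_nonneg (sub_nonneg.2 hxy.le) hd.le)
    (by field_simp; ring)
  have e : ((w0 - y) / (w0 - x)) • x + ((y - x) / (w0 - x)) • w0 = y := by
    simp only [smul_eq_mul]
    field_simp
    ring
  rw [e] at h
  have e1 : (w0 - y) / (w0 - x) = 1 - (y - x) / (w0 - x) := by
    field_simp
    ring
  have : 0 < (y - x) / (w0 - x) := div_pos (sub_pos.2 hxy) hd
  rw [e1] at h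
  simp only [smul_eq_mul] at h
  nlinarith

section SeparationOfVariables

variable {wstar a₀ : ℝ} {H : ℝ → ℝ}

theorem intervalIntegrable_inv_of_neg (hc : ContinuousOn H (Icc wstar a₀))
    (hneg : ∀ w ∈ Ioc wstar a₀, H w < 0) {x y : ℝ} (hx : x ∈ Ioc wstar a₀)
    (hy : y ∈ Ioc wstar a₀) : IntervalIntegrable (fun ζ => (H ζ)⁻¹) volume x y := by
  have hsub : uIcc x y ⊆ Ioc wstar a₀ := ordConnected_Ioc.uIcc_subset hx hy
  exact ((hc.mono (hsub.trans Ioc_subset_Icc_self)).inv₀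
    fun z hz => (hneg z (hsub hz)).ne).intervalIntegrable

theorem travelTime_sub_bounds (hc : ContinuousOn H (Icc wstar a₀))
    (hanti : AntitoneOn H (Icc wstar a₀))
    (hneg : ∀ w ∈ Ioc wstar a₀, H w < 0) {x y : ℝ} (hx : x ∈ Ioc wstar a₀)
    (hy : y ∈ Ioc wstar a₀) (hxy : x ≤ y) :
    (y - x) * (-H y)⁻¹ ≤ (-∫ ζ in x..a₀, (H ζ)⁻¹) - (-∫ ζ in y..a₀, (H ζ)⁻¹) ∧
    (-∫ ζ in x..a₀, (H ζ)⁻¹) - (-∫ ζ in y..a₀, (H ζ)⁻¹) ≤ (y - x) * (-H x)⁻¹ := by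
  have ha : a₀ ∈ Ioc wstar a₀ := ⟨hx.1.trans_le hx.2, le_rfl⟩
  have hi := intervalIntegrable_inv_of_neg hc hneg hx hy
  have e : (-∫ ζ in x..a₀, (H ζ)⁻¹) - (-∫ ζ in y..a₀, (H ζ)⁻¹) = ∫ ζ in x..y, -(H ζ)⁻¹ := by
    rw [← intervalIntegral.integral_add_adjacent_intervals hi
      (intervalIntegrable_inv_of_neg hc hneg hy ha), intervalIntegral.integral_neg]
    ring
  have hi' : IntervalIntegrable (fun ζ => -(H ζ)⁻¹) volume x y := hi.neg
  have hz : ∀ z ∈ Icc x y, z ∈ Ioc wstar a₀ := fun z hz =>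
    ⟨hx.1.trans_le hz.1, hz.2.trans hy.2⟩
  rw [e]
  constructor
  · have h := intervalIntegral.integral_mono_on hxy (intervalIntegrable_const (c := (-H y)⁻¹))
      hi' fun z hzz => by
        rw [← inv_neg]
        exact inv_anti₀ (neg_pos.2 (hneg z (hz z hzz)))
          (neg_le_neg (hanti (Ioc_subset_Icc_self (hz z hzz)) (Ioc_subset_Icc_self hy) hzz.2))
    simpa using h
  · have h := intervalIntegral.integral_mono_on hxy hi'
      (intervalIntegrable_const (c := (-H x)⁻¹)) fun z hzz => by
        rw [← inv_neg]
        exact inv_anti₀ (neg_pos.2 (hneg x hx))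
          (neg_le_neg (hanti (Ioc_subset_Icc_self hx) (Ioc_subset_Icc_self (hz z hzz)) hzz.1))
    simpa using h

theorem exists_travelTime_eq (hlt : wstar < a₀) (hc : ContinuousOn H (Icc wstar a₀))
    (hneg : ∀ w ∈ Ioc wstar a₀, H w < 0) {L : ℝ} (hL : 0 < L)
    (hHL : ∀ w ∈ Icc wstar a₀, -H w ≤ L * (w - wstar)) {c : ℝ} (hc0 : 0 ≤ c) :
    ∃ w ∈ Ioc wstar a₀, -∫ ζ in w..a₀, (H ζ)⁻¹ = c := by
  have ha : a₀ ∈ Ioc wstar a₀ := ⟨hlt, le_rfl⟩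
  set x := wstar + (a₀ - wstar) * Real.exp (-(L * c))
  have hd : 0 < a₀ - wstar := sub_pos.2 hlt
  have hx : x ∈ Ioc wstar a₀ := by
    refine ⟨by simp only [x]; linarith [mul_pos hd (Real.exp_pos (-(L * c)))], ?_⟩
    have : Real.exp (-(L * c)) ≤ 1 := Real.exp_le_one_iff.2 (by nlinarith)
    simp only [x]
    nlinarith
  have hbig : c ≤ -∫ ζ in x..a₀, (H ζ)⁻¹ := by
    have hder : ∀ z ∈ uIcc x a₀,
        HasDerivAt (fun z => Real.log (z - wstar) / L) ((L * (z - wstar))⁻¹) z := by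
      intro z hz
      rw [uIcc_of_le hx.2] at hz
      have hzw : z - wstar ≠ 0 := by linarith [hx.1, hz.1]
      refine HasDerivAt.congr_deriv
        ((((hasDerivAt_id z).sub_const wstar).log hzw).div_const L) ?_
      simp only [id]
      field_simp
    have hcont : IntervalIntegrable (fun z => (L * (z - wstar))⁻¹) volume x a₀ := by
      refine ContinuousOn.intervalIntegrable (ContinuousOn.inv₀ (by fun_prop) fun z hz => ?_)
      rw [uIcc_of_le hx.2] at hz
      have : 0 < z - wstar := by linarith [hx.1, hz.1]
      positivity
    have hint := intervalIntegral.integral_eq_sub_of_hasDerivAt hder hcont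
    have hval : Real.log (x - wstar) = Real.log (a₀ - wstar) - L * c := by
      simp only [x, add_sub_cancel_left]
      rw [Real.log_mul hd.ne' (Real.exp_ne_zero _), Real.log_exp]
      ring
    have hcval : ∫ z in x..a₀, (L * (z - wstar))⁻¹ = c := by
      rw [hint, hval]
      field_simp
      ring
    rw [← intervalIntegral.integral_neg, ← hcval]
    refine intervalIntegral.integral_mono_on hx.2 hcont
      (intervalIntegrable_inv_of_neg hc hneg hx ha).neg fun z hz => ?_
    have hz' : z ∈ Ioc wstar a₀ := ⟨hx.1.trans_le hz.1, hz.2⟩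
    rw [← inv_neg]
    exact inv_anti₀ (neg_pos.2 (hneg z hz')) (hHL z (Ioc_subset_Icc_self hz'))
  have hcontQ : ContinuousOn (fun w => -∫ ζ in w..a₀, (H ζ)⁻¹) (Icc x a₀) := by
    have := intervalIntegral.continuousOn_primitive_interval_left (μ := volume)
      ((intervalIntegrable_iff' (by simp)).1 (intervalIntegrable_inv_of_neg hc hneg hx ha))
    rw [uIcc_of_le hx.2] at this
    exact this.neg
  obtain ⟨w, hw, hwc⟩ := intermediate_value_Icc' hx.2 hcontQ ⟨by simpa using hc0, hbig⟩
  exact ⟨w, ⟨hx.1.trans_le hw.1, hw.2⟩, hwc⟩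

theorem travelTime_inverse_bounds (hc : ContinuousOn H (Icc wstar a₀))
    (hanti : AntitoneOn H (Icc wstar a₀))
    (hneg : ∀ w ∈ Ioc wstar a₀, H w < 0) {x y c d : ℝ} (hx : x ∈ Ioc wstar a₀)
    (hy : y ∈ Ioc wstar a₀) (hxd : -∫ ζ in x..a₀, (H ζ)⁻¹ = d)
    (hyc : -∫ ζ in y..a₀, (H ζ)⁻¹ = c) (hcd : c ≤ d) :
    (d - c) * (-H x) ≤ y - x ∧ y - x ≤ (d - c) * (-H a₀) := by
  have hHx := hneg x hx
  have hHy := hneg y hy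
  have hxy : x ≤ y := by
    by_contra! hlt
    have h := (travelTime_sub_bounds hc hanti hneg hy hx hlt.le).1
    rw [hxd, hyc] at h
    have : 0 < (x - y) * (-H x)⁻¹ := mul_pos (sub_pos.2 hlt) (inv_pos.2 (neg_pos.2 hHx))
    linarith
  obtain ⟨h1, h2⟩ := travelTime_sub_bounds hc hanti hneg hx hy hxy
  rw [hxd, hyc, ← div_eq_mul_inv] at h1 h2
  rw [div_le_iff₀ (neg_pos.2 hHy)] at h1
  rw [le_div_iff₀ (neg_pos.2 hHx)] at h2
  refine ⟨h2, h1.trans ?_⟩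
  refine mul_le_mul_of_nonneg_left (neg_le_neg ?_) (sub_nonneg.2 hcd)
  exact hanti (Ioc_subset_Icc_self hy) ⟨(hx.1.trans_le hx.2).le, le_rfl⟩ hy.2

end SeparationOfVariables

/-- Corollary (case (a)): for a continuous increasing `a : [0,∞) → (w_*, w₀]`,
the equation `g(t) = H(a(t) + ∫₀^t κ(t−s) g(s) ds)` has a unique global continuous
solution, given by `g = H ∘ f` for the unique global continuous solution `f` of
`f(t) = a(t) + ∫₀^t κ(t−s) H(f(s)) ds`; moreover
`H(a(t)) < g(t) ≤ H(Q₁⁻¹(∫₀^t κ, a(0))) < 0` for all `t > 0`. -/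
theorem corollary_volterra_case_a
    (wmax wstar w0 : ℝ) (H : ℝ → ℝ) (hH : AssumptionH wmax wstar H)
    (hw0 : w0 ≤ wmax)
    (hw0min : ∀ w ∈ Set.Iic wmax, H w0 ≤ H w)
    (hw0left : ∀ w ∈ Set.Iic wmax, H w = H w0 → w0 ≤ w)
    (κ : ℝ → ℝ) (hκ : IsLpKernel 1 κ) (hdec : AntitoneOn κ (Set.Ioi 0))
    (hne : ∃ t > 0, κ t ≠ 0)
    (a : ℝ → ℝ) (hacont : ContinuousOn a (Set.Ici 0))
    (hamono : MonotoneOn a (Set.Ici 0))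
    (haval : ∀ t ≥ 0, a t ∈ Set.Ioc wstar w0) :
    let Q1 : ℝ → ℝ := fun w => -∫ ζ in w..(a 0), (H ζ)⁻¹
    let r1 : ℝ → ℝ := fun t =>
      Function.invFunOn Q1 (Set.Ioc wstar (a 0)) (∫ s in (0:ℝ)..t, κ s)
    ∃ f g : ℝ → ℝ,
      (ContinuousOn f (Set.Ici 0) ∧ (∀ t ≥ 0, f t ≤ wmax) ∧
        (∀ t ≥ 0, f t = a t + ∫ s in (0:ℝ)..t, κ (t - s) * H (f s))) ∧
      (∀ f' : ℝ → ℝ,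
        (ContinuousOn f' (Set.Ici 0) ∧ (∀ t ≥ 0, f' t ≤ wmax) ∧
          (∀ t ≥ 0, f' t = a t + ∫ s in (0:ℝ)..t, κ (t - s) * H (f' s))) →
        ∀ t ≥ 0, f' t = f t) ∧
      (∀ t ≥ 0, g t = H (f t)) ∧
      (ContinuousOn g (Set.Ici 0) ∧
        (∀ t ≥ 0, a t + (∫ s in (0:ℝ)..t, κ (t - s) * g s) ≤ wmax ∧
          g t = H (a t + ∫ s in (0:ℝ)..t, κ (t - s) * g s))) ∧
      (∀ g' : ℝ → ℝ,
        (ContinuousOn g' (Set.Ici 0) ∧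
          (∀ t ≥ 0, a t + (∫ s in (0:ℝ)..t, κ (t - s) * g' s) ≤ wmax ∧
            g' t = H (a t + ∫ s in (0:ℝ)..t, κ (t - s) * g' s))) →
        ∀ t ≥ 0, g' t = g t) ∧
      (∀ t > 0, H (a t) < g t ∧ g t ≤ H (r1 t) ∧ H (r1 t) < 0) := by
  intro Q1 r1
  have hκ0 : ∀ t, 0 < t → 0 ≤ κ t := fun t ht => hκ.1 t ht.le
  have hκi : ∀ T, 0 ≤ T → IntervalIntegrable κ volume 0 T := by
    intro T hT
    rcases hT.eq_or_lt with h | h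
    · simp [← h]
    · have := hκ.2.2 T h
      simp only [Real.rpow_one] at this
      exact (intervalIntegrable_iff_integrableOn_Ioc_of_le hT).2 this
  have ha0 := haval 0 le_rfl
  have hstar0 : wstar < w0 := ha0.1.trans_le ha0.2
  have hsanti : StrictAntiOn H (Iic w0) :=
    hH.2.2.1.strictAntiOn_of_leftmost_minimizer hw0 hw0min hw0left
  have hcont : ContinuousOn H (Iic wmax) := hH.2.1.continuousOn
  have hroot : H wstar = 0 := hH.2.2.2.1
  obtain ⟨L, hL⟩ := hH.exists_lipschitzOnWith wstar
  have hcl : ∀ w, max wstar (min w w0) ∈ Icc wstar w0 := fun w =>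
    ⟨le_max_left _ _, max_le hstar0.le (min_le_right _ _)⟩
  set G : ℝ → ℝ := fun w => H (max wstar (min w w0))
  have hGL : LipschitzWith L G := by
    refine LipschitzWith.of_dist_le_mul fun x y => ?_
    have h1 := hL.dist_le_mul _ ⟨(hcl x).1, (hcl x).2.trans hw0⟩ _
      ⟨(hcl y).1, (hcl y).2.trans hw0⟩
    have h2 := ((LipschitzWith.id.min_const w0).const_max wstar).dist_le_mul x y
    simp only [id, NNReal.coe_one, one_mul] at h2
    exact h1.trans (by gcongr)
  have hGanti : Antitone G := fun x y hxy =>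
    hsanti.antitoneOn (hcl x).2 (hcl y).2 (by gcongr)
  have hGH : ∀ w ∈ Ioc wstar w0, G w = H w := fun w hw => by
    simp only [G]
    rw [min_eq_left hw.2, max_eq_right hw.1.le]
  have hHneg : ∀ w ∈ Ioc wstar w0, H w < 0 := fun w hw =>
    hH.neg_of_mem_Ioc ⟨hw.1, hw.2.trans hw0⟩
  have hGneg : ∀ x, G x ≤ 0 := fun x => by
    have := hsanti.antitoneOn (mem_Iic.2 hstar0.le) (hcl x).2 (hcl x).1
    rwa [hroot] at this
  have hGb : ∀ x, |G x| ≤ |H w0| := fun x => by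
    rw [abs_of_nonpos (hGneg x), abs_of_nonpos (hHneg w0 ⟨hstar0, le_rfl⟩).le]
    exact neg_le_neg (hw0min _ ((hcl x).2.trans hw0))
  obtain ⟨f, hfc, hfeq⟩ := exists_volterra_solution hκi hκ0 hdec hacont
    (A := |wstar| + |w0|) (fun t ht => by
      have h := haval t ht
      rw [abs_le]
      constructor <;>
      linarith [h.1, h.2, neg_abs_le wstar, le_abs_self w0, abs_nonneg w0, abs_nonneg wstar])
    hGL hGb
  have hfa : ∀ t ≥ 0, f t ≤ a t := fun t ht => by
    rw [hfeq t ht]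
    linarith [volterra_nonpos hκ0 (h := fun s => G (f s)) (fun s => hGneg (f s)) ht]
  have hf0 : f 0 = a 0 := by simpa using hfeq 0 le_rfl
  have hIsub : Icc wstar (a 0) ⊆ Iic w0 := fun x hx => hx.2.trans ha0.2
  have hIoc : Ioc wstar (a 0) ⊆ Ioc wstar w0 := Ioc_subset_Ioc_right ha0.2
  have hcI : ContinuousOn H (Icc wstar (a 0)) :=
    hcont.mono (hIsub.trans (Iic_subset_Iic.2 hw0))
  have hantiI : AntitoneOn H (Icc wstar (a 0)) := hsanti.antitoneOn.mono hIsub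
  have hnegI : ∀ w ∈ Ioc wstar (a 0), H w < 0 := fun w hw => hHneg w (hIoc hw)
  have hex : ∀ c ≥ 0, ∃ w ∈ Ioc wstar (a 0), Q1 w = c := fun c hc =>
    exists_travelTime_eq ha0.1 hcI hnegI (L := (L : ℝ) + 1) (by positivity) (fun w hw => by
      have h := hL.dist_le_mul w ⟨hw.1, (hIsub hw).trans hw0⟩ wstar
        ⟨le_rfl, hH.1⟩
      rw [Real.dist_eq, Real.dist_eq, hroot, sub_zero, abs_of_nonneg (sub_nonneg.2 hw.1)] at h
      linarith [neg_le_abs (H w), hw.1]) hc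
  set P : ℝ → ℝ := Function.invFunOn Q1 (Ioc wstar (a 0))
  have hPmem : ∀ c ≥ 0, P c ∈ Ioc wstar (a 0) := fun c hc => Function.invFunOn_mem (hex c hc)
  have hPeq : ∀ c ≥ 0, Q1 (P c) = c := fun c hc => Function.invFunOn_eq (hex c hc)
  have hK0 : ∀ t ≥ 0, 0 ≤ ∫ s in (0:ℝ)..t, κ s := fun t ht => by
    simpa using integral_kernel_mono hκi hκ0 le_rfl ht
  have hGP : ∀ c ≥ 0, G (P c) = H (P c) := fun c hc => hGH _ (hIoc (hPmem c hc))
  have hge : ∀ t ≥ 0, r1 t ≤ f t :=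
    volterra_solution_ge hκi hκ0 hdec hamono hGanti hGL hfc hfeq
      (fun c hc => by rw [hGP c hc]; exact hnegI _ (hPmem c hc)) (C := -H (a 0))
      (fun c d hc hcd => by
        have hd : 0 ≤ d := hc.trans hcd
        rw [hGP d hd]
        exact travelTime_inverse_bounds hcI hantiI hnegI (hPmem d hd) (hPmem c hc)
          (hPeq d hd) (hPeq c hc) hcd)
      (by rw [hf0]; exact (hPmem 0 le_rfl).2)
  have hr1 : ∀ t ≥ 0, r1 t ∈ Ioc wstar (a 0) := fun t ht => hPmem _ (hK0 t ht)
  have hfmem : ∀ t ≥ 0, f t ∈ Ioc wstar w0 := fun t ht =>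
    ⟨(hr1 t ht).1.trans_le (hge t ht), (hfa t ht).trans (haval t ht).2⟩
  have hfmax : ∀ t ≥ 0, f t ≤ wmax := fun t ht => (hfmem t ht).2.trans hw0
  have hHcomp : ∀ f' : ℝ → ℝ, ContinuousOn f' (Ici 0) → (∀ t ≥ 0, f' t ≤ wmax) →
      ContinuousOn (fun t => H (f' t)) (Ici 0) := fun f' hc hm => hcont.comp hc hm
  have hfH : ∀ t ≥ 0, f t = a t + ∫ s in (0:ℝ)..t, κ (t - s) * H (f s) := by
    intro t ht
    rw [hfeq t ht]
    congr 1
    refine intervalIntegral.integral_congr fun s hs => ?_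
    rw [uIcc_of_le ht] at hs
    simp only [hGH _ (hfmem s hs.1)]
  have huniq : ∀ f' : ℝ → ℝ,
      (ContinuousOn f' (Ici 0) ∧ (∀ t ≥ 0, f' t ≤ wmax) ∧
        (∀ t ≥ 0, f' t = a t + ∫ s in (0:ℝ)..t, κ (t - s) * H (f' s))) →
      ∀ t ≥ 0, f' t = f t := by
    rintro f' ⟨hf'c, hf'm, hf'⟩
    refine volterra_solution_unique hκi hκ0 hdec hf'c hfc (hHcomp f' hf'c hf'm)
      (hHcomp f hfc hfmax) (fun T hT => ?_) hf' hfH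
    have hsub : Icc 0 T ⊆ Ici (0:ℝ) := fun x hx => hx.1
    obtain ⟨M, hM⟩ := isCompact_Icc.exists_bound_of_continuousOn (hf'c.mono hsub)
    obtain ⟨M', hM'⟩ := isCompact_Icc.exists_bound_of_continuousOn (hfc.mono hsub)
    obtain ⟨L', hL'⟩ := hH.exists_lipschitzOnWith (min (-M) (-M'))
    refine ⟨L', L'.2, fun t ht => ?_⟩
    exact hL'.dist_le_mul _
      ⟨(min_le_left _ _).trans (abs_le.1 (hM t ht)).1, hf'm t ht.1⟩ _
      ⟨(min_le_right _ _).trans (abs_le.1 (hM' t ht)).1, hfmax t ht.1⟩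
  refine ⟨f, fun t => H (f t), ⟨hfc, hfmax, hfH⟩, huniq, fun _ _ => rfl,
    ⟨hHcomp f hfc hfmax, fun t ht => ?_⟩, ?_, fun t ht => ⟨?_, ?_, ?_⟩⟩
  · rw [← hfH t ht]
    exact ⟨hfmax t ht, rfl⟩
  · rintro g' ⟨hg'c, hg'⟩ t ht
    set f' : ℝ → ℝ := fun t => a t + ∫ s in (0:ℝ)..t, κ (t - s) * g' s
    have hf' : ∀ t ≥ 0, f' t = f t := by
      refine huniq f' ⟨hacont.add (continuousOn_volterra hκi hg'c), fun t ht => (hg' t ht).1,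
        fun t ht => ?_⟩
      simp only [f', add_right_inj]
      refine intervalIntegral.integral_congr fun s hs => ?_
      rw [uIcc_of_le ht] at hs
      exact congrArg (κ (t - s) * ·) (hg' s hs.1).2
    rw [(hg' t ht).2]
    exact congrArg H (hf' t ht)
  · have hlt : f t < a t := by
      rw [hfH t ht.le]
      linarith [volterra_neg hκi hκ0 hdec hne (hHcomp f hfc hfmax)
        (fun s hs => hHneg _ (hfmem s hs)) ht]
    exact hsanti (hfmem t ht.le).2 (haval t ht.le).2 hlt
  · exact hsanti.antitoneOn (hIoc (hr1 t ht.le)).2 (hfmem t ht.le).2 (hge t ht.le)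
  · exact hnegI _ (hr1 t ht.le)
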